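/- Let α = gcd(α_x, α_y, α_z), β_p = α_p/α, with β_y odd. Then there exists a logical operator P with P^Z = 0 (only X-flips) whose support {d ∈ D : P^X(d) = 1} has cardinality exactly 2β_yβ_zα (a rigid chain of length 2β_yβ_zα), i.e., P satisfies ω(S_s, P) = 0 for all s ∈ A \ D and P ∉ 𝒮; similarly, there exists a logical operator with P^X = 0 (only Z-flips) whose support has cardinality exactly 2β_yβ_xα. -/

import Mathlib

namespace Chamon

/-- Ambient group `A = ZMod (2αx) × ZMod (2αy) × ZMod (2αz)`. -/
abbrev Amb (ax ay az : ℕ) : Type :=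
  ZMod (2 * ax) × ZMod (2 * ay) × ZMod (2 * az)

/-- Reduction mod 2 of a coordinate. -/
def par {n : ℕ} (a : ZMod (2 * n)) : ZMod 2 :=
  ZMod.castHom (dvd_mul_right 2 n) (ZMod 2) a

variable (ax ay az : ℕ)

def ex : Amb ax ay az := (1, 0, 0)
def ey : Amb ax ay az := (0, 1, 0)
def ez : Amb ax ay az := (0, 0, 1)

/-- The data-qubit set `D`. -/
def dataSet : Set (Amb ax ay az) :=
  {a | par a.1 + par a.2.1 + par a.2.2 = 0}

/-- A Pauli operator (modulo phase): a pair of functions `D → ZMod 2`. -/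
abbrev Pauli : Type :=
  (↥(dataSet ax ay az) → ZMod 2) × (↥(dataSet ax ay az) → ZMod 2)

/-- The stabilizer generator `S_s`. -/
def stab (s : Amb ax ay az) : Pauli ax ay az :=
  (fun d =>
      (if (d : Amb ax ay az) = s + ex ax ay az then 1 else 0) +
      (if (d : Amb ax ay az) = s - ex ax ay az then 1 else 0) +
      (if (d : Amb ax ay az) = s + ey ax ay az then 1 else 0) +
      (if (d : Amb ax ay az) = s - ey ax ay az then 1 else 0),
   fun d =>
      (if (d : Amb ax ay az) = s + ez ax ay az then 1 else 0) +
      (if (d : Amb ax ay az) = s - ez ax ay az then 1 else 0) +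
      (if (d : Amb ax ay az) = s + ey ax ay az then 1 else 0) +
      (if (d : Amb ax ay az) = s - ey ax ay az then 1 else 0))

/-- The symplectic form `ω(P,Q)`. -/
noncomputable def sympl (P Q : Pauli ax ay az) : ZMod 2 :=
  ∑ᶠ d : ↥(dataSet ax ay az), (P.1 d * Q.2 d + P.2 d * Q.1 d)

/-- `X|_E`: X-part is the indicator of `E`, Z-part is zero. -/
noncomputable def Xop (E : Set (Amb ax ay az)) : Pauli ax ay az :=
  (fun d => E.indicator (fun _ => (1 : ZMod 2)) (d : Amb ax ay az), fun _ => 0)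

/-- `Z|_E`: Z-part is the indicator of `E`, X-part is zero. -/
noncomputable def Zop (E : Set (Amb ax ay az)) : Pauli ax ay az :=
  (fun _ => 0, fun d => E.indicator (fun _ => (1 : ZMod 2)) (d : Amb ax ay az))

/-- The `ZMod 2`-linear span `𝒮` of the stabilizer generators. -/
def stabSpan : Submodule (ZMod 2) (Pauli ax ay az) :=
  Submodule.span (ZMod 2) (stab ax ay az '' (dataSet ax ay az)ᶜ)

/-- The four generating points `g₀, g₁, g₂, g₃`. -/
def gpt : Fin 4 → Amb ax ay az := ![(0,0,0), (1,1,0), (1,0,1), (0,1,1)]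

/-- Half-plane support `D_x^g` (parallel to the `yOz` plane). -/
def Dxg (g : Amb ax ay az) : Set (Amb ax ay az) :=
  {d | ∃ l m : ℤ, d = g + (2*l) • ez ax ay az + (2*m) • ey ax ay az}

/-- Half-plane support `D_z^g` (parallel to the `xOy` plane). -/
def Dzg (g : Amb ax ay az) : Set (Amb ax ay az) :=
  {d | ∃ l m : ℤ, d = g + (2*l) • ex ax ay az + (2*m) • ey ax ay az}

end Chamon

namespace Chamon

/-- Reduction `ZMod (2 * n) → ZMod (2 * k)` for `n` a multiple `b * k` of `k`. -/
def red {n b k : ℕ} (h : n = b * k) : ZMod (2 * n) →+* ZMod (2 * k) :=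
  ZMod.castHom (mul_dvd_mul_left 2 (h ▸ dvd_mul_left k b)) (ZMod (2 * k))

lemma red_surjective {n b k : ℕ} (h : n = b * k) : Function.Surjective (red h) :=
  ZMod.castHom_surjective _

lemma par_red {n b k : ℕ} (h : n = b * k) (a : ZMod (2 * n)) : par (red h a) = par a :=
  RingHom.congr_fun (Subsingleton.elim
    ((ZMod.castHom (dvd_mul_right 2 k) (ZMod 2)).comp (red h))
    (ZMod.castHom (dvd_mul_right 2 n) (ZMod 2))) a

lemma par_add {n : ℕ} (a b : ZMod (2 * n)) : par (a + b) = par a + par b := map_add _ a b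

lemma par_sub {n : ℕ} (a b : ZMod (2 * n)) : par (a - b) = par a - par b := map_sub _ a b

lemma par_zero {n : ℕ} : par (0 : ZMod (2 * n)) = 0 := map_zero _

lemma par_one {n : ℕ} : par (1 : ZMod (2 * n)) = 1 := map_one _

lemma par_add_par_eq_zero {n b m c k : ℕ} (h : n = b * k) (h' : m = c * k)
    {y : ZMod (2 * n)} {z : ZMod (2 * m)} (hyz : red h y + red h' z = 0) :
    par y + par z = 0 := by
  rw [← par_red h, ← par_red h', ← par_add, hyz, par_zero]

lemma card_ker_mul {G H : Type*} [AddGroup G] [AddGroup H] {f : G →+ H}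
    (hf : Function.Surjective f) : Nat.card f.ker * Nat.card H = Nat.card G := by
  rw [← f.ker.card_mul_index, AddSubgroup.index_ker, AddMonoidHom.range_eq_top.mpr hf,
    AddSubgroup.card_top]

lemma card_red_ker {n b k : ℕ} (h : n = b * k) (hk : 0 < k) :
    Nat.card (red h).toAddMonoidHom.ker = b := by
  have := card_ker_mul (f := (red h).toAddMonoidHom) (red_surjective h)
  simp only [Nat.card_zmod] at this
  refine Nat.eq_of_mul_eq_mul_right (show 0 < 2 * k by omega) (this.trans ?_)
  rw [h]; ring

lemma card_red_coprod_ker {n b m c k : ℕ} (h : n = b * k) (h' : m = c * k) (hk : 0 < k) :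
    Nat.card ((red h).toAddMonoidHom.coprod (red h').toAddMonoidHom).ker = 2 * b * c * k := by
  have hs : Function.Surjective ((red h).toAddMonoidHom.coprod (red h').toAddMonoidHom) := by
    intro t
    obtain ⟨y, rfl⟩ := red_surjective h t
    exact ⟨(y, 0), by simp⟩
  have := card_ker_mul hs
  simp only [Nat.card_zmod, Nat.card_prod] at this
  refine Nat.eq_of_mul_eq_mul_right (show 0 < 2 * k by omega) (this.trans ?_)
  rw [h, h']; ring

variable {ax ay az : ℕ}

lemma mem_dataSet {d : Amb ax ay az} :
    d ∈ dataSet ax ay az ↔ par d.1 + par d.2.1 + par d.2.2 = 0 := Iff.rfl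

lemma neighbors_mem_dataSet {s : Amb ax ay az} (hs : s ∉ dataSet ax ay az) :
    (s + ex ax ay az ∈ dataSet ax ay az ∧ s - ex ax ay az ∈ dataSet ax ay az) ∧
    (s + ey ax ay az ∈ dataSet ax ay az ∧ s - ey ax ay az ∈ dataSet ax ay az) ∧
    (s + ez ax ay az ∈ dataSet ax ay az ∧ s - ez ax ay az ∈ dataSet ax ay az) := by
  simp only [mem_dataSet, ex, ey, ez, Prod.fst_add, Prod.snd_add, Prod.fst_sub, Prod.snd_sub,
    par_add, par_sub, par_zero, par_one] at hs ⊢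
  generalize par s.1 = a at *
  generalize par s.2.1 = b at *
  generalize par s.2.2 = c at *
  revert a b c
  decide

lemma finsum_ite_mul (p : Amb ax ay az → ZMod 2) {t : Amb ax ay az}
    (ht : t ∈ dataSet ax ay az) :
    ∑ᶠ d : dataSet ax ay az, (if (d : Amb ax ay az) = t then 1 else 0) * p d = p t := by
  rw [finsum_eq_single _ (⟨t, ht⟩ : dataSet ax ay az)]
  · simp
  · intro d hd
    rw [if_neg fun h => hd (Subtype.ext h), zero_mul]

lemma sympl_comm (P Q : Pauli ax ay az) : sympl ax ay az P Q = sympl ax ay az Q P :=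
  finsum_congr fun d => by ring

/-- The points of the plane `x = 0` with `y + z ≡ 0` mod `2k`. -/
def chainYZ {b bz k : ℕ} (hy : ay = b * k) (hz : az = bz * k) : Set (Amb ax ay az) :=
  {d | d.1 = 0 ∧ red hy d.2.1 + red hz d.2.2 = 0}

/-- The points of the plane `z = 0` with `y + x ≡ 0` mod `2k`. -/
def chainYX {b bx k : ℕ} (hy : ay = b * k) (hx : ax = bx * k) : Set (Amb ax ay az) :=
  {d | d.2.2 = 0 ∧ red hy d.2.1 + red hx d.1 = 0}

lemma chainYZ_subset {b bz k : ℕ} (hy : ay = b * k) (hz : az = bz * k) :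
    chainYZ hy hz ⊆ dataSet ax ay az := by
  rintro d ⟨h0, h⟩
  rw [mem_dataSet, h0, par_zero, zero_add, par_add_par_eq_zero hy hz h]

lemma chainYX_subset {b bx k : ℕ} (hy : ay = b * k) (hx : ax = bx * k) :
    chainYX hy hx ⊆ dataSet ax ay az := by
  rintro d ⟨h0, h⟩
  rw [mem_dataSet, h0, par_zero, add_zero, add_comm, par_add_par_eq_zero hy hx h]

lemma ncard_subtype_setOf_mem {β : Type*} {D E : Set β} (h : E ⊆ D) :
    {d : D | (d : β) ∈ E}.ncard = E.ncard := by
  rw [← Set.ncard_image_of_injective _ Subtype.val_injective]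
  congr 1
  ext d
  simpa using @h d

lemma indicator_pair_add_pair {β : Type*} {E : Set β} {t u v w : β} (h : t ∈ E ↔ v ∈ E)
    (h' : u ∈ E ↔ w ∈ E) :
    E.indicator (fun _ => (1 : ZMod 2)) t + E.indicator (fun _ => 1) u +
      E.indicator (fun _ => 1) v + E.indicator (fun _ => 1) w = 0 := by
  classical
  simp only [Set.indicator_apply, h, h']
  split_ifs <;> decide

variable {bx b bz k : ℕ} (hx : ax = bx * k) (hy : ay = b * k) (hz : az = bz * k)

lemma ncard_chainYZ (hk : 0 < k) :
    (chainYZ hy hz : Set (Amb ax ay az)).ncard = 2 * b * bz * k := by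
  rw [← card_red_coprod_ker hy hz hk, ← Nat.card_range_of_injective
    (f := fun p : ((red hy).toAddMonoidHom.coprod (red hz).toAddMonoidHom).ker =>
      ((0, p.1.1, p.1.2) : Amb ax ay az)), Set.ncard]
  · congr 2
    ext ⟨x, y, z⟩
    simp [chainYZ, AddMonoidHom.mem_ker, eq_comm, and_comm]
  · rintro ⟨⟨y, z⟩, h⟩ ⟨⟨y', z'⟩, h'⟩ heq
    exact Subtype.ext (by simpa using heq)

lemma ncard_chainYX (hk : 0 < k) :
    (chainYX hy hx : Set (Amb ax ay az)).ncard = 2 * b * bx * k := by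
  rw [← card_red_coprod_ker hy hx hk, ← Nat.card_range_of_injective
    (f := fun p : ((red hy).toAddMonoidHom.coprod (red hx).toAddMonoidHom).ker =>
      ((p.1.2, p.1.1, 0) : Amb ax ay az)), Set.ncard]
  · congr 2
    ext ⟨x, y, z⟩
    simp [chainYX, AddMonoidHom.mem_ker, eq_comm, and_comm]
  · rintro ⟨⟨y, z⟩, h⟩ ⟨⟨y', z'⟩, h'⟩ heq
    exact Subtype.ext (by simpa [and_comm] using heq)

lemma ncard_chainYZ_inter_chainYX (hk : 0 < k) :
    (chainYZ hy hz ∩ chainYX hy hx : Set (Amb ax ay az)).ncard = b := by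
  conv_rhs => rw [← card_red_ker hy hk]
  rw [← Nat.card_range_of_injective
    (f := fun p : (red hy).toAddMonoidHom.ker => ((0, p.1, 0) : Amb ax ay az)), Set.ncard]
  · congr 2
    ext ⟨x, y, z⟩
    simp only [chainYZ, chainYX, Set.mem_inter_iff, Set.mem_ofPred_eq, Set.mem_range,
      Subtype.exists, AddMonoidHom.mem_ker, Prod.mk.injEq, exists_prop]
    constructor
    · rintro ⟨⟨rfl, h⟩, rfl, -⟩
      exact ⟨y, by simpa using h, rfl, rfl, rfl⟩
    · rintro ⟨y, h, rfl, rfl, rfl⟩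
      have h : red hy y = 0 := h
      simp [h]
  · rintro ⟨y, h⟩ ⟨y', h'⟩ heq
    exact Subtype.ext (by simpa using heq)

variable [NeZero (2 * ax)] [NeZero (2 * ay)] [NeZero (2 * az)]

lemma finsum_four_ite_mul (p : Amb ax ay az → ZMod 2) {t u v w : Amb ax ay az}
    (ht : t ∈ dataSet ax ay az) (hu : u ∈ dataSet ax ay az)
    (hv : v ∈ dataSet ax ay az) (hw : w ∈ dataSet ax ay az) :
    ∑ᶠ d : dataSet ax ay az, ((if (d : Amb ax ay az) = t then 1 else 0) +
      (if (d : Amb ax ay az) = u then 1 else 0) + (if (d : Amb ax ay az) = v then 1 else 0) +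
      (if (d : Amb ax ay az) = w then 1 else 0)) * p d = p t + p u + p v + p w := by
  simp only [add_mul]
  rw [finsum_add_distrib (Set.toFinite _) (Set.toFinite _),
    finsum_add_distrib (Set.toFinite _) (Set.toFinite _),
    finsum_add_distrib (Set.toFinite _) (Set.toFinite _)]
  simp only [finsum_ite_mul p, ht, hu, hv, hw]

lemma sympl_stab_Xop (E : Set (Amb ax ay az)) {s : Amb ax ay az} (hs : s ∉ dataSet ax ay az) :
    sympl ax ay az (stab ax ay az s) (Xop ax ay az E) =
      E.indicator (fun _ => 1) (s + ez ax ay az) + E.indicator (fun _ => 1) (s - ez ax ay az) +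
      E.indicator (fun _ => 1) (s + ey ax ay az) + E.indicator (fun _ => 1) (s - ey ax ay az) := by
  obtain ⟨-, ⟨hy, hy'⟩, hz, hz'⟩ := neighbors_mem_dataSet hs
  rw [← finsum_four_ite_mul _ hz hz' hy hy']
  simp only [sympl, Xop, stab, mul_zero, zero_add]

lemma sympl_stab_Zop (E : Set (Amb ax ay az)) {s : Amb ax ay az} (hs : s ∉ dataSet ax ay az) :
    sympl ax ay az (stab ax ay az s) (Zop ax ay az E) =
      E.indicator (fun _ => 1) (s + ex ax ay az) + E.indicator (fun _ => 1) (s - ex ax ay az) +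
      E.indicator (fun _ => 1) (s + ey ax ay az) + E.indicator (fun _ => 1) (s - ey ax ay az) := by
  obtain ⟨⟨hx, hx'⟩, ⟨hy, hy'⟩, -⟩ := neighbors_mem_dataSet hs
  rw [← finsum_four_ite_mul _ hx hx' hy hy']
  simp only [sympl, Zop, stab, mul_zero, add_zero]

lemma sympl_add_left (P P' Q : Pauli ax ay az) :
    sympl ax ay az (P + P') Q = sympl ax ay az P Q + sympl ax ay az P' Q := by
  simp only [sympl]
  rw [← finsum_add_distrib (Set.toFinite _) (Set.toFinite _)]
  refine finsum_congr fun d => ?_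
  simp only [Prod.fst_add, Prod.snd_add, Pi.add_apply]
  ring

/-- An operator that anticommutes with some operator commuting with all generators is not
a stabilizer. -/
lemma notMem_stabSpan {P Q : Pauli ax ay az}
    (hQ : ∀ s ∉ dataSet ax ay az, sympl ax ay az (stab ax ay az s) Q = 0)
    (hPQ : sympl ax ay az P Q ≠ 0) : P ∉ stabSpan ax ay az := by
  refine fun hP => hPQ ?_
  clear hPQ
  induction hP using Submodule.span_induction with
  | mem _ h => obtain ⟨s, hs, rfl⟩ := h; exact hQ s hs
  | zero => simp [sympl]
  | add _ _ _ _ h h' => rw [sympl_add_left, h, h', add_zero]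
  | smul c _ _ h =>
    obtain rfl | rfl : c = 0 ∨ c = 1 := by revert c; decide
    · simp [sympl]
    · rwa [one_smul]

lemma sympl_Xop_Zop (E F : Set (Amb ax ay az)) :
    sympl ax ay az (Xop ax ay az E) (Zop ax ay az F) =
      ({d : dataSet ax ay az | (d : Amb ax ay az) ∈ E ∩ F}.ncard : ZMod 2) := by
  classical
  have := Fintype.ofFinite (dataSet ax ay az)
  rw [sympl, finsum_eq_sum_of_fintype, Set.ncard_eq_toFinset_card']
  simp only [Xop, Zop, Set.indicator_apply, add_zero, Set.mem_inter_iff,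
    Set.toFinset_ofPred, ← ite_and, mul_ite, mul_one, mul_zero, Finset.sum_boole, and_comm]

lemma sympl_stab_chainYZ {s : Amb ax ay az} (hs : s ∉ dataSet ax ay az) :
    sympl ax ay az (stab ax ay az s) (Xop ax ay az (chainYZ hy hz)) = 0 := by
  rw [sympl_stab_Xop _ hs]
  apply indicator_pair_add_pair <;>
    simp [chainYZ, ey, ez, add_assoc, add_comm, add_left_comm, sub_eq_add_neg]

lemma sympl_stab_chainYX {s : Amb ax ay az} (hs : s ∉ dataSet ax ay az) :
    sympl ax ay az (stab ax ay az s) (Zop ax ay az (chainYX hy hx)) = 0 := by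
  rw [sympl_stab_Zop _ hs]
  apply indicator_pair_add_pair <;>
    simp [chainYX, ey, ex, add_assoc, add_comm, add_left_comm, sub_eq_add_neg]

lemma sympl_chainYZ_chainYX_ne_zero (hk : 0 < k) (hodd : Odd b) :
    sympl ax ay az (Xop ax ay az (chainYZ hy hz)) (Zop ax ay az (chainYX hy hx)) ≠ 0 := by
  rw [sympl_Xop_Zop, ncard_subtype_setOf_mem (Set.inter_subset_left.trans (chainYZ_subset hy hz)),
    ncard_chainYZ_inter_chainYX hx hy hz hk, ZMod.natCast_eq_one_iff_odd.mpr hodd]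
  exact one_ne_zero

end Chamon

open Chamon

/-- with `α = gcd(αx,αy,αz)`, `βp = αp/α` and `βy` odd, there is a
logical operator consisting only of X-flips whose support is a rigid chain of
length `2βyβzα`, and a logical operator consisting only of Z-flips whose support
has cardinality `2βyβxα`. -/
theorem chamon_rigid_chain_logical_operators (ax ay az α βx βy βz : ℕ)
    (hax : 2 ≤ ax) (hay : 2 ≤ ay) (haz : 2 ≤ az)
    (hα : α = Nat.gcd (Nat.gcd ax ay) az)
    (hβx : ax = βx * α) (hβy : ay = βy * α) (hβz : az = βz * α)
    (hodd : Odd βy) :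
    (∃ P : Pauli ax ay az, P.2 = 0 ∧
        {d : ↥(dataSet ax ay az) | P.1 d = 1}.ncard = 2 * βy * βz * α ∧
        (∀ s ∉ dataSet ax ay az, sympl ax ay az (stab ax ay az s) P = 0) ∧
        P ∉ stabSpan ax ay az) ∧
    (∃ Q : Pauli ax ay az, Q.1 = 0 ∧
        {d : ↥(dataSet ax ay az) | Q.2 d = 1}.ncard = 2 * βy * βx * α ∧
        (∀ s ∉ dataSet ax ay az, sympl ax ay az (stab ax ay az s) Q = 0) ∧
        Q ∉ stabSpan ax ay az) := by
  have hk : 0 < α := Nat.pos_of_ne_zero (by rintro rfl; omega)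
  have : NeZero (2 * ax) := ⟨by omega⟩
  have : NeZero (2 * ay) := ⟨by omega⟩
  have : NeZero (2 * az) := ⟨by omega⟩
  have hne := sympl_chainYZ_chainYX_ne_zero hβx hβy hβz hk hodd
  refine ⟨⟨Xop ax ay az (chainYZ hβy hβz), rfl, ?_, fun s hs => sympl_stab_chainYZ hβy hβz hs,
    notMem_stabSpan (fun s hs => sympl_stab_chainYX hβx hβy hs) hne⟩,
    ⟨Zop ax ay az (chainYX hβy hβx), rfl, ?_, fun s hs => sympl_stab_chainYX hβx hβy hs,
    notMem_stabSpan (fun s hs => sympl_stab_chainYZ hβy hβz hs) (by rwa [sympl_comm])⟩⟩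
  · rw [← ncard_chainYZ (ax := ax) hβy hβz hk, ← ncard_subtype_setOf_mem (chainYZ_subset hβy hβz)]
    congr 1
    ext d
    simp [Xop]
  · rw [← ncard_chainYX (az := az) hβx hβy hk, ← ncard_subtype_setOf_mem (chainYX_subset hβy hβx)]
    congr 1
    ext d
    simp [Zop]
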